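/- Let Γ be a commutative thick weakly distance-regular digraph and q ≥ 2 with (1,q-1) ∈ ∂̃(Γ). Then the configuration C(q) or D(q) exists if and only if (1,q-1) is mixed. -/

import Mathlib

/-!
Common framework: commutative thick weakly distance-regular digraphs.
-/

variable {V : Type*}

/-- There is a directed walk of length `n` from `x` to `y`. -/
def HasWalk (adj : V → V → Prop) (x y : V) (n : ℕ) : Prop :=
  ∃ f : ℕ → V, f 0 = x ∧ f n = y ∧ ∀ i < n, adj (f i) (f (i + 1))

/-- Directed distance `∂(x,y)`. -/
noncomputable def ddist (adj : V → V → Prop) (x y : V) : ℕ :=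
  sInf {n | HasWalk adj x y n}

/-- Two-way distance `∂̃(x,y) = (∂(x,y), ∂(y,x))`. -/
noncomputable def tdist (adj : V → V → Prop) (x y : V) : ℕ × ℕ :=
  (ddist adj x y, ddist adj y x)

/-- The pair `i` is an attained two-way distance, i.e. `i ∈ ∂̃(Γ)`. -/
def Attained (adj : V → V → Prop) (i : ℕ × ℕ) : Prop :=
  ∃ x y : V, tdist adj x y = i

/-- Intersection number `p^h_{i,j}`: for attained `h` it is the common cardinality of
`{z | ∂̃(x,z) = i, ∂̃(z,y) = j}` over pairs with `∂̃(x,y) = h` (and `0` otherwise). -/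
noncomputable def pnum (adj : V → V → Prop) (h i j : ℕ × ℕ) : ℕ :=
  sSup {n | ∃ x y : V, tdist adj x y = h ∧
    n = Set.ncard {z : V | tdist adj x z = i ∧ tdist adj z y = j}}

/-- Valency `k_i = |Γ_i(x)|`. -/
noncomputable def kval (adj : V → V → Prop) (i : ℕ × ℕ) : ℕ :=
  pnum adj (0, 0) i i.swap

/-- Adjacency of the subdigraph `Δ_J`: arcs of type `(1, t-1)` for `t ∈ J`. -/
def deltaAdj (adj : V → V → Prop) (J : Set ℕ) (u v : V) : Prop :=
  ∃ t ∈ J, tdist adj u v = (1, t - 1)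

/-- A circuit of length `s`. -/
def IsCircuit (adj : V → V → Prop) (s : ℕ) (f : ℕ → V) : Prop :=
  0 < s ∧ f s = f 0 ∧ ∀ i < s, adj (f i) (f (i + 1))

/-- Strongly connected. -/
def IsStrong (adj : V → V → Prop) : Prop :=
  ∀ x y : V, ∃ n, HasWalk adj x y n

/-- Weakly distance-regular: the intersection numbers are well defined. -/
def IsWDR (adj : V → V → Prop) : Prop :=
  ∀ (i j : ℕ × ℕ) (x y x' y' : V), tdist adj x y = tdist adj x' y' →
    Set.ncard {z : V | tdist adj x z = i ∧ tdist adj z y = j}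
      = Set.ncard {z : V | tdist adj x' z = i ∧ tdist adj z y' = j}

/-- Thick: `p^h_{i,i}, p^h_{i,i*} ∈ {0, k_i}`. -/
def IsThick (adj : V → V → Prop) : Prop :=
  ∀ h i : ℕ × ℕ,
    (pnum adj h i i = 0 ∨ pnum adj h i i = kval adj i) ∧
    (pnum adj h i i.swap = 0 ∨ pnum adj h i i.swap = kval adj i)

/-- A thick weakly distance-regular digraph (as a property of an adjacency relation). -/
def IsWDRThick (adj : V → V → Prop) : Prop :=
  IsStrong adj ∧ IsWDR adj ∧ IsThick adj

/-- A commutative thick weakly distance-regular digraph. -/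
structure CTWDR (V : Type*) [Fintype V] where
  adj : V → V → Prop
  loopless : ∀ v, ¬ adj v v
  strong : IsStrong adj
  wdr : IsWDR adj
  comm : ∀ (i j : ℕ × ℕ) (x y : V),
    Set.ncard {z : V | tdist adj x z = i ∧ tdist adj z y = j}
      = Set.ncard {z : V | tdist adj x z = j ∧ tdist adj z y = i}
  thick : IsThick adj

namespace CTWDR

variable {V : Type*} [Fintype V] (G : CTWDR V)

/-- Product `EF` of two sets of relations (relations identified with two-way distances). -/
def prodS (E F : Set (ℕ × ℕ)) : Set (ℕ × ℕ) :=
  {h | ∃ i ∈ E, ∃ j ∈ F, pnum G.adj h i j ≠ 0}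

/-- Powers `Γ_i^l` (with `Γ_i^0 = {Γ_{(0,0)}}` and `Γ_i^1 = {Γ_i}`). -/
def pow (i : ℕ × ℕ) : ℕ → Set (ℕ × ℕ)
  | 0 => {(0, 0)}
  | 1 => {i}
  | n + 2 => G.prodS (pow i (n + 1)) {i}

/-- The pair `(1, s-1)` is pure: every circuit of length `s` containing an arc of type
`(1, s-1)` consists of arcs of type `(1, s-1)`. -/
def Pure (s : ℕ) : Prop :=
  ∀ f : ℕ → V, IsCircuit G.adj s f →
    (∃ i < s, tdist G.adj (f i) (f (i + 1)) = (1, s - 1)) →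
    ∀ i < s, tdist G.adj (f i) (f (i + 1)) = (1, s - 1)

/-- `(1, s-1)` is mixed. -/
def Mixed (s : ℕ) : Prop := ¬ G.Pure s

/-- Configuration `C(q)` exists. -/
def Cexists (q : ℕ) : Prop :=
  pnum G.adj (1, q - 2) (1, q - 1) (1, q - 1) ≠ 0 ∧ G.Pure (q - 1)

/-- Configuration `D(q)` exists. -/
def Dexists (q : ℕ) : Prop :=
  pnum G.adj (1, q - 1) (1, q - 2) (q - 2, 1) ≠ 0 ∧ G.Pure (q - 1)

/-- A closed set of relations: `Γ_{i*}Γ_j ⊆ F` for all `i, j ∈ F`. -/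
def Closed (F : Set (ℕ × ℕ)) : Prop :=
  ∀ i ∈ F, ∀ j ∈ F, G.prodS {i.swap} {j} ⊆ F

/-- The minimal closed set `⟨F⟩` containing `F`. -/
def genClosed (F : Set (ℕ × ℕ)) : Set (ℕ × ℕ) :=
  ⋂₀ {C | F ⊆ C ∧ G.Closed C}

/-- The block `F_J(x)` of the closed set generated by `{Γ_{1,t-1}}_{t ∈ J}`. -/
def block (J : Set ℕ) (x : V) : Set V :=
  {y | tdist G.adj x y ∈ G.genClosed {i | ∃ t ∈ J, i = (1, t - 1)}}

end CTWDR

namespace CTWDR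

variable {V : Type*} [Fintype V] (G : CTWDR V)

theorem walk_append {adj : V → V → Prop} {x y z : V} {n m : ℕ}
    (h1 : HasWalk adj x y n) (h2 : HasWalk adj y z m) : HasWalk adj x z (n + m) := by
  obtain ⟨f, f0, fn, hf⟩ := h1
  obtain ⟨g, g0, gm, hg⟩ := h2
  refine ⟨fun i => if i ≤ n then f i else g (i - n), by simp [f0], ?_, ?_⟩
  · by_cases hm : m = 0
    · subst hm
      simp [fn, ← gm, g0]
    · have : ¬ (n + m ≤ n) := by omega
      simp [this, gm, hm]
  · intro i hi
    by_cases h : i + 1 ≤ n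
    · have h' : i ≤ n := by omega
      simp only [h, h', if_true]
      exact hf i (by omega)
    · by_cases h' : i ≤ n
      · have : i = n := by omega
        subst this
        simp only [h, h', if_true, if_false, fn, ← g0]
        have := hg 0 (by omega)
        simpa using this
      · simp only [h, h', if_false]
        have := hg (i - n) (by omega)
        rwa [show i - n + 1 = i + 1 - n by omega] at this

theorem dd_walk (x y : V) : HasWalk G.adj x y (ddist G.adj x y) := Nat.sInf_mem (G.strong x y)

theorem dd_le {x y : V} {n : ℕ} (h : HasWalk G.adj x y n) : ddist G.adj x y ≤ n := Nat.sInf_le h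

theorem dd_self (x : V) : ddist G.adj x x = 0 := by
  have := G.dd_le (x := x) (y := x) (n := 0) ⟨fun _ => x, rfl, rfl, by simp⟩
  omega

theorem dd_zero {x y : V} (h : ddist G.adj x y = 0) : x = y := by
  have := G.dd_walk x y
  rw [h] at this
  obtain ⟨f, f0, f1, -⟩ := this
  rw [← f0, ← f1]

theorem dd_tri (x y z : V) : ddist G.adj x z ≤ ddist G.adj x y + ddist G.adj y z :=
  G.dd_le (walk_append (G.dd_walk x y) (G.dd_walk y z))

theorem dd_one {x y : V} : G.adj x y ↔ ddist G.adj x y = 1 := by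
  constructor
  · intro h
    have h1 : ddist G.adj x y ≤ 1 := G.dd_le ⟨fun i => if i = 0 then x else y, by simp, by simp, by
      intro i hi
      have : i = 0 := by omega
      subst this
      simpa using h⟩
    have h2 : ddist G.adj x y ≠ 0 := by
      intro h0
      have := G.dd_zero h0
      subst this
      exact G.loopless _ h
    omega
  · intro h
    have := G.dd_walk x y
    rw [h] at this
    obtain ⟨f, f0, f1, hf⟩ := this
    have := hf 0 (by omega)
    rw [f0] at this
    simpa [f1] using this

/-- Transfer of paths between pairs with the same two-way distance. -/
theorem tr {x y x' y' z : V} {i j : ℕ × ℕ} (h : tdist G.adj x y = tdist G.adj x' y')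
    (h1 : tdist G.adj x z = i) (h2 : tdist G.adj z y = j) :
    ∃ z', tdist G.adj x' z' = i ∧ tdist G.adj z' y' = j := by
  have e := G.wdr i j x y x' y' h
  have hne : Set.ncard {z : V | tdist G.adj x z = i ∧ tdist G.adj z y = j} ≠ 0 :=
    Set.ncard_ne_zero_of_mem (a := z) ⟨h1, h2⟩
  rw [e] at hne
  exact Set.nonempty_of_ncard_ne_zero hne

theorem cm {x y z : V} {i j : ℕ × ℕ}
    (h1 : tdist G.adj x z = i) (h2 : tdist G.adj z y = j) :
    ∃ z', tdist G.adj x z' = j ∧ tdist G.adj z' y = i := by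
  have e := G.comm i j x y
  have hne : Set.ncard {z : V | tdist G.adj x z = i ∧ tdist G.adj z y = j} ≠ 0 :=
    Set.ncard_ne_zero_of_mem (a := z) ⟨h1, h2⟩
  rw [e] at hne
  exact Set.nonempty_of_ncard_ne_zero hne

theorem td_swap (x y : V) : tdist G.adj y x = (tdist G.adj x y).swap := rfl

theorem td_swap' {x y : V} {i : ℕ × ℕ} : tdist G.adj y x = i.swap ↔ tdist G.adj x y = i := by
  rw [td_swap]
  exact Prod.swap_inj

theorem td_self (x : V) : tdist G.adj x x = (0, 0) := by
  simp [tdist, dd_self]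

theorem pnum_eq {x y : V} (i j : ℕ × ℕ) : pnum G.adj (tdist G.adj x y) i j =
    Set.ncard {z : V | tdist G.adj x z = i ∧ tdist G.adj z y = j} := by
  have : {n | ∃ x' y' : V, tdist G.adj x' y' = tdist G.adj x y ∧
    n = Set.ncard {z : V | tdist G.adj x' z = i ∧ tdist G.adj z y' = j}} =
    {Set.ncard {z : V | tdist G.adj x z = i ∧ tdist G.adj z y = j}} := by
    ext n
    constructor
    · rintro ⟨x', y', h, rfl⟩
      exact G.wdr i j x' y' x y h
    · rintro rfl
      exact ⟨x, y, rfl, rfl⟩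
  rw [pnum, this, csSup_singleton]

theorem pnum_ne {h i j : ℕ × ℕ} : pnum G.adj h i j ≠ 0 ↔
    ∃ x z y, tdist G.adj x y = h ∧ tdist G.adj x z = i ∧ tdist G.adj z y = j := by
  constructor
  · intro hn
    by_cases ha : ∃ x y, tdist G.adj x y = h
    · obtain ⟨x, y, rfl⟩ := ha
      rw [G.pnum_eq] at hn
      obtain ⟨z, hz⟩ := Set.nonempty_of_ncard_ne_zero hn
      exact ⟨x, z, y, rfl, hz.1, hz.2⟩
    · exfalso
      apply hn
      have : {n | ∃ x' y' : V, tdist G.adj x' y' = h ∧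
        n = Set.ncard {z : V | tdist G.adj x' z = i ∧ tdist G.adj z y' = j}} = ∅ := by
        ext n
        simp only [Set.mem_ofPred_eq, Set.mem_empty_iff_false, iff_false]
        rintro ⟨x, y, h, -⟩
        exact ha ⟨x, y, h⟩
      rw [pnum, this]
      simp
  · rintro ⟨x, z, y, rfl, h1, h2⟩
    rw [G.pnum_eq]
    exact Set.ncard_ne_zero_of_mem (a := z) ⟨h1, h2⟩

theorem thk {x y z w : V} {i : ℕ × ℕ} (h1 : tdist G.adj x z = i) (h2 : tdist G.adj y z = i)
    (h3 : tdist G.adj x w = i) : tdist G.adj y w = i := by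
  have hne : pnum G.adj (tdist G.adj x y) i i.swap ≠ 0 :=
    G.pnum_ne.2 ⟨x, z, y, rfl, h1, (G.td_swap').2 h2⟩
  have hk := ((G.thick (tdist G.adj x y) i).2).resolve_left hne
  rw [G.pnum_eq, kval, ← G.td_self x, G.pnum_eq] at hk
  have hs := Set.eq_of_subset_of_ncard_le
    (s := {z : V | tdist G.adj x z = i ∧ tdist G.adj z y = i.swap})
    (t := {z : V | tdist G.adj x z = i ∧ tdist G.adj z x = i.swap})
    (fun z hz => ⟨hz.1, (G.td_swap').2 hz.1⟩) hk.ge (Set.toFinite _)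
  have : w ∈ {z : V | tdist G.adj x z = i ∧ tdist G.adj z x = i.swap} :=
    ⟨h3, (G.td_swap').2 h3⟩
  rw [← hs] at this
  exact (G.td_swap').1 this.2

/-- Arc of type `(1,t-1)`. -/
def A (t : ℕ) (x y : V) : Prop := tdist G.adj x y = (1, t - 1)

theorem A_dd {t : ℕ} {x y : V} (h : G.A t x y) : ddist G.adj x y = 1 ∧ ddist G.adj y x = t - 1 :=
  ⟨congrArg Prod.fst h, congrArg Prod.snd h⟩

theorem A_ge {t : ℕ} {x y : V} (h : G.A t x y) : 2 ≤ t := by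
  obtain ⟨h1, h2⟩ := G.A_dd h
  by_contra hc
  have : ddist G.adj y x = 0 := by omega
  have := G.dd_zero this
  subst this
  rw [G.dd_self] at h1
  omega

theorem A_inj {t s : ℕ} {x y : V} (h : G.A t x y) (h' : G.A s x y) : t = s := by
  have := G.A_ge h
  have := G.A_ge h'
  have := (G.A_dd h).2
  have := (G.A_dd h').2
  omega

theorem A_adj {x y : V} (h : G.adj x y) : G.A (ddist G.adj y x + 1) x y := by
  simp [A, tdist, G.dd_one.1 h]

theorem A_irr {t : ℕ} {x : V} (h : G.A t x x) : False := by
  have := (G.A_dd h).1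
  rw [G.dd_self] at this
  omega

theorem A_ex {t : ℕ} {x y : V} (h : G.A t x y) (x' : V) : ∃ y', G.A t x' y' := by
  obtain ⟨z, hz, -⟩ := G.tr (x := x) (y := x) (x' := x') (y' := x') (z := y)
    (by rw [td_self, td_self]) h rfl
  exact ⟨z, hz⟩

/-- Walk with a prescribed list of arc types. -/
def W : List ℕ → V → V → Prop
  | [], x, y => x = y
  | t :: l, x, y => ∃ z, G.A t x z ∧ W l z y

theorem W_append {l l' : List ℕ} {x y : V} :
    G.W (l ++ l') x y ↔ ∃ z, G.W l x z ∧ G.W l' z y := by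
  induction l generalizing x with
  | nil => simp [W]
  | cons t l ih =>
    simp only [List.cons_append, W, ih]
    constructor
    · rintro ⟨z, h, w, h1, h2⟩
      exact ⟨w, ⟨z, h, h1⟩, h2⟩
    · rintro ⟨w, ⟨z, h, h1⟩, h2⟩
      exact ⟨z, h, w, h1, h2⟩

theorem W_perm {l l' : List ℕ} (hp : l.Perm l') {x y : V} (h : G.W l x y) : G.W l' x y := by
  induction hp generalizing x with
  | nil => exact h
  | cons t _ ih =>
    obtain ⟨z, h1, h2⟩ := h
    exact ⟨z, h1, ih h2⟩
  | swap a b l =>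
    obtain ⟨z, h1, w, h2, h3⟩ := h
    obtain ⟨u, h4, h5⟩ := G.cm h1 h2
    exact ⟨u, h4, w, h5, h3⟩
  | trans _ _ ih1 ih2 => exact ih2 (ih1 h)

theorem W_dd {l : List ℕ} {x y : V} (h : G.W l x y) : ddist G.adj x y ≤ l.length := by
  induction l generalizing x with
  | nil =>
    cases h
    simp [G.dd_self]
  | cons t l ih =>
    obtain ⟨z, h1, h2⟩ := h
    have := ih h2
    have := G.dd_tri x z y
    have := (G.A_dd h1).1
    simp only [List.length_cons]
    omega

theorem W_walk {n : ℕ} {x y : V} (h : HasWalk G.adj x y n) : ∃ l, l.length = n ∧ G.W l x y := by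
  induction n generalizing x with
  | zero =>
    obtain ⟨f, f0, f1, -⟩ := h
    exact ⟨[], rfl, by rw [W, ← f0, ← f1]⟩
  | succ n ih =>
    obtain ⟨f, f0, f1, hf⟩ := h
    obtain ⟨l, hl, hw⟩ := ih (x := f 1) ⟨fun i => f (i + 1), rfl, f1, fun i hi => hf (i+1) (by omega)⟩
    have := hf 0 (by omega)
    rw [f0] at this
    exact ⟨_ :: l, by simp [hl], _, G.A_adj this, hw⟩

theorem W_ex (x y : V) : ∃ l, l.length = ddist G.adj x y ∧ G.W l x y := G.W_walk (G.dd_walk x y)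

def Circ (l : List ℕ) : Prop := ∃ x, G.W l x x

theorem C_perm {l l' : List ℕ} (h : G.Circ l) (hp : l.Perm l') : G.Circ l' := by
  obtain ⟨x, h⟩ := h
  exact ⟨x, G.W_perm hp h⟩

theorem C_att {t : ℕ} {l : List ℕ} (h : G.Circ l) (ht : t ∈ l) : ∃ x y, G.A t x y := by
  obtain ⟨x, z, h1, h2⟩ := G.C_perm h (List.perm_cons_erase ht)
  exact ⟨x, z, h1⟩

theorem C_le {t : ℕ} {l : List ℕ} (h : G.Circ l) (ht : t ∈ l) : t ≤ l.length := by
  have hp := List.perm_cons_erase ht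
  obtain ⟨x, z, h1, h2⟩ := G.C_perm h hp
  have := G.W_dd h2
  have := (G.A_dd h1).2
  have := hp.length_eq
  simp only [List.length_cons] at this
  omega

theorem C_ge {t : ℕ} {l : List ℕ} (h : G.Circ l) (ht : t ∈ l) : 2 ≤ t := by
  obtain ⟨x, y, h⟩ := G.C_att h ht
  exact G.A_ge h

def PureL (s : ℕ) : Prop := ∀ l, G.Circ (s :: l) → l.length + 1 = s → ∀ t ∈ l, t = s

theorem fun_of_W {l : List ℕ} {x y : V} (h : G.W l x y) :
    ∃ f : ℕ → V, f 0 = x ∧ f l.length = y ∧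
      ∀ i (hi : i < l.length), G.A l[i] (f i) (f (i + 1)) := by
  induction l generalizing x with
  | nil => exact ⟨fun _ => x, rfl, h, by simp⟩
  | cons t l ih =>
    obtain ⟨z, h1, h2⟩ := h
    obtain ⟨f, f0, f1, hf⟩ := ih h2
    refine ⟨fun i => Nat.casesOn i x f, rfl, f1, ?_⟩
    intro i hi
    cases i with
    | zero => simpa [f0] using h1
    | succ i => simpa using hf i (by simpa using hi)

theorem W_of_fun (f : ℕ → V) (n : ℕ) (hf : ∀ i < n, G.adj (f i) (f (i + 1))) :
    G.W ((List.range n).map (fun i => ddist G.adj (f (i + 1)) (f i) + 1)) (f 0) (f n) := by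
  induction n with
  | zero => simp [W]
  | succ n ih =>
    rw [List.range_succ, List.map_append, W_append]
    exact ⟨f n, ih (fun i hi => hf i (by omega)), f (n+1), G.A_adj (hf n (by omega)), rfl⟩

theorem pure_iff {s : ℕ} : G.Pure s ↔ G.PureL s := by
  constructor
  · intro hP l ⟨x, hl⟩ hs t ht
    obtain ⟨f, f0, f1, hf⟩ := G.fun_of_W hl
    have hlen : (s :: l).length = s := by simpa using hs
    have h1 := hP f ⟨by omega, by rw [f0, ← hlen, f1], fun i hi =>
      G.dd_one.2 (G.A_dd (hf i (by omega))).1⟩ ⟨0, by omega, hf 0 (by simp)⟩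
    obtain ⟨i, hi, rfl⟩ := List.getElem_of_mem (List.mem_cons_of_mem s ht)
    exact G.A_inj (hf i hi) (h1 i (by omega))
  · intro hP f ⟨hs, hc, hf⟩ ⟨i, hi, hti⟩ j hj
    have hw := G.W_of_fun f s hf
    set L := (List.range s).map (fun i => ddist G.adj (f (i + 1)) (f i) + 1) with hL
    rw [hc] at hw
    have hm : ∀ j < s, ddist G.adj (f (j + 1)) (f j) + 1 ∈ L := fun j hj => by
      rw [hL]
      exact List.mem_map.2 ⟨j, List.mem_range.2 hj, rfl⟩
    have hsi : ddist G.adj (f (i + 1)) (f i) = s - 1 := congrArg Prod.snd hti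
    have hsL : s ∈ L := by
      have := hm i hi
      rwa [hsi, Nat.sub_add_cancel hs] at this
    have hp := List.perm_cons_erase hsL
    have hlen := hp.length_eq
    have h1 := hP (L.erase s) (G.C_perm ⟨_, hw⟩ hp) (by
      rw [hL, List.length_map, List.length_range, ← hL] at hlen
      simpa using hlen.symm)
    have h2 : ddist G.adj (f (j + 1)) (f j) + 1 = s := by
      have := hp.mem_iff.1 (hm j hj)
      rcases List.mem_cons.1 this with h | h
      · exact h
      · exact h1 _ h
    have h3 := G.dd_one.1 (hf j hj)
    simp [tdist, h3, ← h2]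

/-- `x` and `y` have the same out-neighbours of type `(1,o-1)`. -/
def E (o : ℕ) (x y : V) : Prop := ∃ z, G.A o x z ∧ G.A o y z

theorem E_symm {o : ℕ} {x y : V} (h : G.E o x y) : G.E o y x := by
  obtain ⟨z, h1, h2⟩ := h
  exact ⟨z, h2, h1⟩

theorem E_out {o : ℕ} {x y w : V} (h : G.E o x y) (hw : G.A o x w) : G.A o y w := by
  obtain ⟨z, h1, h2⟩ := h
  exact G.thk h1 h2 hw

theorem E_trans {o : ℕ} {x y z : V} (h : G.E o x y) (h' : G.E o y z) : G.E o x z := by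
  obtain ⟨w, h1, h2⟩ := h
  exact ⟨w, h1, G.E_out h' h2⟩

theorem E_in {o : ℕ} {x y w : V} (h : G.E o x y) (hw : G.A o w x) : G.A o w y := by
  obtain ⟨z, h1, h2⟩ := h
  obtain ⟨u, h3, h4⟩ := G.cm h1 ((G.td_swap').2 h2)
  exact (G.td_swap').1 (G.thk h3 ((G.td_swap').2 h4) ((G.td_swap').2 hw))

theorem E_of_in {o : ℕ} {x y z : V} (h1 : G.A o z x) (h2 : G.A o z y) : G.E o x y := by
  obtain ⟨u, h3, h4⟩ := G.cm ((G.td_swap').2 h1) h2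
  exact ⟨u, h3, (G.td_swap').1 h4⟩

theorem E_irr {o : ℕ} {x y : V} (h : G.A o x y) (h' : G.E o x y) : False :=
  G.A_irr (G.E_out h' h)

theorem E_ge {o : ℕ} {x y : V} (h : G.E o x y) : 2 ≤ o := by
  obtain ⟨z, h1, h2⟩ := h
  exact G.A_ge h1

/-- `h ∈ s t`. -/
def P (h : ℕ × ℕ) (s t : ℕ) : Prop := ∃ x z y, tdist G.adj x y = h ∧ G.A s x z ∧ G.A t z y

theorem P_comm {h : ℕ × ℕ} {s t : ℕ} (hp : G.P h s t) : G.P h t s := by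
  obtain ⟨x, z, y, h0, h1, h2⟩ := hp
  obtain ⟨u, h3, h4⟩ := G.cm h1 h2
  exact ⟨x, u, y, h0, h3, h4⟩

theorem P_use {h : ℕ × ℕ} {s t : ℕ} (hp : G.P h s t) {x y : V} (hx : tdist G.adj x y = h) :
    ∃ z, G.A s x z ∧ G.A t z y := by
  obtain ⟨x', z, y', h0, h1, h2⟩ := hp
  exact G.tr (h0.trans hx.symm) h1 h2

/-- Exchange. -/
theorem exch {h : ℕ × ℕ} {q s e : ℕ} (h1 : G.P h q s) (h2 : G.P h q e) {l : List ℕ} {x y : V}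
    (hw : G.W (q :: s :: l) x y) : G.W (q :: e :: l) x y := by
  obtain ⟨z, hz, w, hs, hl⟩ := hw
  obtain ⟨x0, z0, y0, h0, a1, a2⟩ := h1
  obtain ⟨z1, b1, b2⟩ := G.P_use h2 h0
  obtain ⟨z2, c1, c2⟩ := G.tr (a2.trans hs.symm) (rfl : tdist G.adj z0 z1 = _) b2
  have hE : G.E q z z2 := by
    obtain ⟨u, d1, d2⟩ := G.E_of_in a1 b1
    obtain ⟨u', e1, e2⟩ := G.tr c1.symm d1 ((G.td_swap').2 d2)
    exact ⟨u', e1, (G.td_swap').1 e2⟩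
  exact ⟨z2, G.E_in hE hz, w, c2, hl⟩

theorem exchC {h : ℕ × ℕ} {q s e : ℕ} (h1 : G.P h q s) (h2 : G.P h q e) {l : List ℕ}
    (hw : G.Circ (q :: s :: l)) : G.Circ (q :: e :: l) := by
  obtain ⟨x, hx⟩ := hw
  exact ⟨x, G.exch h1 h2 hx⟩

theorem exch_all {h : ℕ × ℕ} {q f : ℕ} (h2 : G.P h q f) {l : List ℕ} (hl : ∀ s ∈ l, G.P h q s)
    {x y : V} (hw : G.W (q :: l) x y) : G.W (q :: List.replicate l.length f) x y := by
  induction l generalizing x with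
  | nil => exact hw
  | cons s l ih =>
    have h3 := G.exch (hl s (by simp)) h2 hw
    obtain ⟨z, h4, h5⟩ := G.W_perm (List.Perm.swap _ _ _) h3
    have h6 := ih (fun s hs => hl s (by simp [hs])) h5
    exact G.W_perm (List.Perm.swap _ _ _) (⟨z, h4, h6⟩ : G.W (f :: q :: _) x y)

theorem step {q s : ℕ} {l : List ℕ} (hc : G.Circ (q :: s :: l)) (hl : l.length + 2 = q)
    (hq : 3 ≤ q) : (G.P (1, q - 2) q s ∧ G.Circ ((q - 1) :: l)) ∨ G.P (2, q - 2) q s := by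
  obtain ⟨x, z, h1, y, h2, h3⟩ := hc
  have d1 := G.W_dd h3
  have d2 := G.dd_tri z y x
  have d3 := (G.A_dd h1).2
  have d4 := (G.A_dd h1).1
  have d5 := (G.A_dd h2).1
  have d6 := G.dd_tri x z y
  have d7 : ddist G.adj y x = q - 2 := by omega
  have d8 : ddist G.adj x y ≠ 0 := by
    intro h
    have := G.dd_zero h
    subst this
    omega
  have d9 : ddist G.adj x y = 1 ∨ ddist G.adj x y = 2 := by omega
  rcases d9 with d9 | d9
  · left
    have e : tdist G.adj x y = (1, q - 2) := by simp [tdist, d7, d9]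
    exact ⟨⟨x, z, y, e, h1, h2⟩, x, y, e, h3⟩
  · right
    have e : tdist G.adj x y = (2, q - 2) := by simp [tdist, d7, d9]
    exact ⟨x, z, y, e, h1, h2⟩

/-- Circuit shorter than an arc allows. -/
theorem short {q : ℕ} {l : List ℕ} (hc : G.Circ l) (h : q ∈ l) (hl : l.length < q) : False := by
  have := G.C_le hc h
  omega

/-- replace an arc by a path -/
theorem ins {p q e : ℕ} {l : List ℕ} (hr : G.P (1, p - 1) q e) (hc : G.Circ (p :: l)) :
    G.Circ (q :: e :: l) := by
  obtain ⟨x, y, h1, h2⟩ := hc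
  obtain ⟨z, h3, h4⟩ := G.P_use hr h1
  exact ⟨x, z, h3, y, h4, h2⟩

/-- `p ∈ q p` gives `q ⊆ H_p`. -/
theorem E_of_P {p q : ℕ} (hr : G.P (1, p - 1) q p) {x y : V} (h : G.A q x y) : G.E p x y := by
  obtain ⟨a, c, b, h0, h1, h2⟩ := hr
  obtain ⟨u, h3, h4⟩ := G.tr (h1.trans h.symm) (h0 : G.A p a b) ((G.td_swap').2 h2)
  exact ⟨u, h3, (G.td_swap').1 h4⟩

/-- absorption -/
theorem absb {p o : ℕ} (hE : ∀ x y, G.A p x y → G.E o x y) {l : List ℕ}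
    (hc : G.Circ (p :: o :: l)) : G.Circ (o :: l) := by
  obtain ⟨x, y, h1, z, h2, h3⟩ := hc
  exact ⟨x, z, G.E_out (G.E_symm (hE _ _ h1)) h2, h3⟩

/-- coset lemma -/
theorem coset {o n : ℕ} {x y y' : V} (h : G.W (List.replicate (n + 1) o) x y)
    (h' : G.W (List.replicate (n + 1) o) x y') : G.E o y y' := by
  induction n generalizing x with
  | zero =>
    obtain ⟨z, h1, rfl⟩ := h
    obtain ⟨z', h2, rfl⟩ := h'
    exact G.E_of_in h1 h2
  | succ n ih =>
    obtain ⟨z, h1, h2⟩ := h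
    obtain ⟨z', h3, w, h4, h5⟩ := h'
    exact ih h2 ⟨w, G.E_out (G.E_of_in h3 h1) h4, h5⟩

/-- powers of a pure arc type. -/
theorem pure_pow {o : ℕ} (hp : G.PureL o) {a b : V} (ha : G.A o a b) (x : V) :
    G.W (List.replicate o o) x x := by
  obtain ⟨y, h⟩ := G.A_ex ha x
  obtain ⟨l, hl, hw⟩ := G.W_ex y x
  have h2 := G.A_ge h
  have h3 := (G.A_dd h).2
  have hlo : l.length + 1 = o := by omega
  have := hp l ⟨x, y, h, hw⟩ hlo
  have hrep := List.eq_replicate_of_mem this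
  have : o :: l = List.replicate o o := by
    conv_rhs => rw [← hlo]
    rw [List.replicate_succ, hlo, ← hrep]
  rw [← this]
  exact ⟨y, h, hw⟩

theorem pure_E {o : ℕ} (hp : G.PureL o) {x y : V} (h : G.E o x y) :
    G.W (List.replicate o o) x y := by
  have h2 := G.E_ge h
  obtain ⟨z, h1, -⟩ := id h
  have h3 := G.pure_pow hp h1 x
  obtain ⟨n, rfl⟩ : ∃ n, o = n + 1 := ⟨o - 1, by omega⟩
  rw [List.replicate_succ', W_append] at h3 ⊢
  obtain ⟨w, h4, u, h5, rfl⟩ := h3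
  exact ⟨w, h4, y, G.E_in h h5, rfl⟩

theorem E_pure {o : ℕ} (hp : G.PureL o) (ho : 2 ≤ o) {x y : V} (h : G.W (List.replicate o o) x y) :
    G.E o x y := by
  obtain ⟨n, rfl⟩ : ∃ n, o = n + 1 := ⟨o - 1, by omega⟩
  obtain ⟨z, h1, h2⟩ := id h
  exact G.coset (G.pure_pow hp h1 x) h

/-- `o ∈ p p`, `o = p - 1`: three consecutive arcs of type `p` shorten. -/
theorem three {p o : ℕ} (hr : G.P (1, o - 1) p p) {l : List ℕ}
    (hc : G.Circ (p :: p :: p :: l)) : G.Circ (o :: p :: l) := by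
  obtain ⟨x, a, h1, b, h2, c, h3, h4⟩ := hc
  obtain ⟨x', a', y', h0, h5, h6⟩ := id hr
  obtain ⟨b', h7⟩ := G.A_ex (t := o) h0 x
  obtain ⟨a'', h8, h9⟩ := G.P_use hr h7
  have e1 : G.E p a a'' := G.E_of_in h1 h8
  have e2 : G.E p b b' := G.E_of_in (G.E_out e1 h2) h9
  exact ⟨x, b', h7, c, G.E_out e2 h3, h4⟩

theorem E_mono {p o : ℕ} (hr : G.P (1, o - 1) p p) {x y : V} (h : G.E o x y) : G.E p x y := by
  obtain ⟨z, h1, h2⟩ := h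
  obtain ⟨a, h3, h4⟩ := G.P_use hr h1
  obtain ⟨b, h5, h6⟩ := G.P_use hr h2
  exact ⟨a, h3, G.E_in ⟨z, h6, h4⟩ h5⟩

def CL (q : ℕ) : Prop := G.PureL (q - 1) ∧ G.P (1, q - 2) q q

def DL (q : ℕ) : Prop := G.PureL (q - 1) ∧ ∀ x y, G.A q x y → G.E (q - 1) x y

theorem CL_ge {q : ℕ} (h : G.CL q) : 3 ≤ q := by
  obtain ⟨-, x, z, y, h0, h1, h2⟩ := h
  have := G.A_ge (t := q - 1) (x := x) (y := y) h0
  omega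

/-- Lemma X -/
theorem X {q f : ℕ} {l : List ℕ} (IH : ∀ f < q, G.PureL f ∨ G.CL f ∨ G.DL f)
    (hc : G.Circ (q :: l)) (hl : l.length + 1 = q) (hB : ∀ s ∈ l, G.P (2, q - 2) q s)
    (hf : f ∈ l) (hfq : f < q) : f + 1 = q ∧ G.DL q := by
  have hf2 := G.C_ge hc (List.mem_cons_of_mem _ hf)
  obtain ⟨x, hx⟩ := hc
  have h1 := G.exch_all (hB f hf) hB hx
  obtain ⟨n, rfl⟩ : ∃ n, q = n + 1 := ⟨_, hl.symm⟩
  have hn : l.length = n := by omega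
  rw [hn] at h1
  obtain ⟨y, hq, h2⟩ := h1
  rcases IH f hfq with hp | hC | hD
  · by_cases hfn : f = n
    · subst hfn
      refine ⟨rfl, hp, ?_⟩
      intro a b hab
      have hE : G.E f x y := G.E_symm (G.E_pure hp hf2 h2)
      obtain ⟨u, h3, h4⟩ := hE
      obtain ⟨v, h5, h6⟩ := G.tr (hq.trans hab.symm) h3 ((G.td_swap').2 h4)
      exact ⟨v, h5, (G.td_swap').1 h6⟩
    · exfalso
      obtain ⟨k, rfl⟩ : ∃ k, n = f + (k + 1) := ⟨n - f - 1, by omega⟩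
      rw [List.replicate_add, W_append] at h2
      obtain ⟨z, h3, w, h4, h5⟩ := h2
      have hE := G.E_pure hp hf2 h3
      have hc : G.Circ ((f + (k + 1) + 1) :: f :: List.replicate k f) :=
        ⟨x, y, hq, w, G.E_out (G.E_symm hE) h4, h5⟩
      exact G.short hc List.mem_cons_self (by simp; omega)
  · exfalso
    have := G.CL_ge hC
    obtain ⟨k, rfl⟩ : ∃ k, n = k + 3 := ⟨n - 3, by omega⟩
    have hc : G.Circ ((k + 3 + 1) :: f :: f :: f :: List.replicate k f) := ⟨x, y, hq, h2⟩
    have hc := G.C_perm hc (l' := f :: f :: f :: (k + 3 + 1) :: List.replicate k f)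
      (List.perm_iff_count.2 fun a => by simp only [List.count_cons]; ring)
    have hc := G.three (o := f - 1) hC.2 hc
    exact G.short (q := k + 3 + 1) hc (by simp) (by simp)
  · exfalso
    have key : ∀ m a b, G.W (List.replicate (m + 1) f) a b → G.E (f - 1) a b := by
      intro m
      induction m with
      | zero =>
        rintro a b ⟨c, h3, rfl⟩
        exact hD.2 _ _ h3
      | succ m ih =>
        rintro a b ⟨c, h3, h4⟩
        exact G.E_trans (hD.2 _ _ h3) (ih _ _ h4)
    obtain ⟨m, rfl⟩ : ∃ m, n = m + 1 := ⟨n - 1, by omega⟩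
    have hE := key m _ _ h2
    have hc : G.Circ ((m + 1 + 1) :: List.replicate (f - 1) (f - 1)) :=
      ⟨x, y, hq, G.pure_E hD.1 hE⟩
    exact G.short hc List.mem_cons_self (by simp; omega)

theorem stepMem {q s : ℕ} {l : List ℕ} (hc : G.Circ (q :: l)) (hl : l.length + 1 = q)
    (hq : 3 ≤ q) (hs : s ∈ l) :
    (G.P (1, q - 2) q s ∧ G.Circ ((q - 1) :: l.erase s)) ∨ G.P (2, q - 2) q s := by
  have hp := List.perm_cons_erase hs
  have := hp.length_eq
  simp only [List.length_cons] at this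
  exact G.step (G.C_perm hc (hp.cons q)) (by omega) hq

theorem pureCase {n f : ℕ} {l : List ℕ} (hn : 1 ≤ n)
    (IH : ∀ f < n + 2, G.PureL f ∨ G.CL f ∨ G.DL f) (hp : G.PureL (n + 1))
    (hc : G.Circ ((n + 2) :: l)) (hl : l.length + 1 = n + 2) (hf : f ∈ l) (hfq : f ≠ n + 2) :
    G.CL (n + 2) ∨ G.DL (n + 2) := by
  have hfle := G.C_le hc (List.mem_cons_of_mem _ hf)
  simp only [List.length_cons] at hfle
  by_cases hB : ∀ s ∈ l, G.P (2, n + 2 - 2) (n + 2) s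
  · exact Or.inr (G.X IH hc hl hB hf (by omega)).2
  push Not at hB
  obtain ⟨s, hs, hsB⟩ := hB
  obtain ⟨hr, hc1⟩ := (G.stepMem hc hl (by omega) hs).resolve_right hsB
  have hsle := G.C_le hc (List.mem_cons_of_mem _ hs)
  simp only [List.length_cons] at hsle
  have hperm := List.perm_cons_erase hs
  have hlen := hperm.length_eq
  simp only [List.length_cons] at hlen
  have hall := hp _ hc1 (by omega)
  have hrep := List.eq_replicate_of_mem hall
  have hc2 := G.C_perm hc (hperm.cons (n + 2))
  rw [hrep, show (l.erase s).length = n by omega] at hc2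
  clear hall hrep hperm hc1
  have hD : G.P (1, n + 2 - 2) (n + 2) (n + 1) → G.DL (n + 2) := fun h =>
    ⟨hp, fun x y hxy => G.E_of_P (p := n + 1) h hxy⟩
  by_cases hsq : s = n + 2
  · subst hsq
    exact Or.inl ⟨hp, hr⟩
  by_cases hsp : s = n + 1
  · subst hsp
    exact Or.inr (hD hr)
  obtain ⟨m, rfl⟩ : ∃ m, n = m + 1 := ⟨n - 1, by omega⟩
  rw [List.replicate_succ] at hc2
  have hc3 := G.C_perm hc2 (l' := (m + 1 + 2) :: (m + 1 + 1) :: s :: List.replicate m (m + 1 + 1))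
      (List.perm_iff_count.2 fun a => by simp only [List.count_cons]; ring)
  rcases G.step hc3 (by simp) (by omega) with h | hBp
  · exact Or.inr (hD h.1)
  have hc4 := G.C_perm hc2 (l' := s :: (m + 1 + 1) :: (m + 1 + 2) :: List.replicate m (m + 1 + 1))
      (List.perm_iff_count.2 fun a => by simp only [List.count_cons]; ring)
  obtain ⟨x, a, h1, y, h2, h3⟩ := id hc4
  have d1 := G.W_dd h3
  simp only [List.length_cons, List.length_replicate] at d1
  obtain ⟨w, hw, hW⟩ := G.W_ex y x
  have hcw : G.Circ (s :: (m + 1 + 1) :: w) := ⟨x, a, h1, y, h2, hW⟩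
  have d2 := G.C_le (t := m + 1 + 1) hcw (by simp)
  simp only [List.length_cons] at d2
  have d3 : ddist G.adj y x = m + 1 := by
    by_contra hne
    have hcw' := G.C_perm hcw (List.Perm.swap _ _ _)
    exact hsp (hp _ hcw' (by simp; omega) s (by simp))
  have d4 : ddist G.adj x y ≠ 0 := by
    intro h
    have := G.dd_zero h
    subst this
    omega
  have d5 := G.dd_tri x a y
  have d6 := (G.A_dd h1).1
  have d7 := (G.A_dd h2).1
  rcases (by omega : ddist G.adj x y = 1 ∨ ddist G.adj x y = 2) with d | d
  · exfalso
    have e : tdist G.adj x y = (1, m + 1) := by simp [tdist, d, d3]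
    have hE : ∀ x y, G.A s x y → G.E (m + 1 + 1) x y :=
      fun u v huv => G.E_of_P (p := m + 1 + 1) ⟨x, a, y, e, h1, h2⟩ huv
    have hc5 := G.absb hE hc4
    exact G.short (q := m + 1 + 2) hc5 (by simp) (by simp)
  · have e : tdist G.adj x y = (2, m + 1) := by simp [tdist, d, d3]
    obtain ⟨b, h4, h5⟩ := G.P_use hBp e
    have hc5 : G.Circ ((m + 1 + 2) :: (m + 1 + 1) :: (m + 1 + 2) :: List.replicate m (m + 1 + 1)) :=
      ⟨x, b, h4, y, h5, h3⟩
    have hc6 := G.C_perm hc5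
      (l' := (m + 1 + 2) :: (m + 1 + 2) :: (m + 1 + 1) :: List.replicate m (m + 1 + 1))
      (List.perm_iff_count.2 fun a => by simp only [List.count_cons]; ring)
    rcases G.step hc6 (by simp) (by omega) with h | hBq
    · exact Or.inl ⟨hp, h.1⟩
    · refine Or.inr (G.X (f := m + 1 + 1) IH hc6 (by simp) ?_ (by simp) (by omega)).2
      intro t ht
      simp only [List.mem_cons, List.mem_replicate] at ht
      rcases ht with rfl | rfl | ⟨-, rfl⟩
      · exact hBq
      · exact hBp
      · exact hBp

/-- circuits `p,p,w` of length `p` with `(2,p-2) ∈ pp`. -/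
theorem ppw {p : ℕ} {w : List ℕ} (hp3 : 3 ≤ p) (IH : ∀ f < p, G.PureL f ∨ G.CL f ∨ G.DL f)
    (hc : G.Circ (p :: p :: w)) (hl : w.length + 2 = p) (hB : G.P (2, p - 2) p p) :
    (∀ t ∈ w, t = p) ∨ (p - 1 ∈ w ∧ G.DL p) := by
  by_cases h : ∀ t ∈ w, t = p
  · exact Or.inl h
  right
  push Not at h
  obtain ⟨f, hf, hfp⟩ := h
  have hle := G.C_le (t := f) hc (by simp [hf])
  simp only [List.length_cons] at hle
  have hx := G.X (f := f) IH hc (by simp; omega) (by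
    intro s hs
    rcases List.mem_cons.1 hs with rfl | hs'
    · exact hB
    · have hp := List.perm_cons_erase hs'
      have hlen := hp.length_eq
      simp only [List.length_cons] at hlen
      have hc1 := G.C_perm hc (l' := p :: s :: p :: w.erase s)
        (((hp.cons p).trans (List.Perm.swap _ _ _)).cons p)
      rcases G.step hc1 (by simp; omega) hp3 with h | h
      · exact (G.short (q := p) h.2 (by simp) (by simp; omega)).elim
      · exact h) (by simp [hf]) (by omega)
  refine ⟨?_, hx.2⟩
  rw [← hx.1]
  exact hf

theorem caseD {o e : ℕ} (ho : 2 ≤ o) (IH : ∀ f < o + 1, G.PureL f ∨ G.CL f ∨ G.DL f)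
    (hp : G.PureL o) (hD : ∀ x y, G.A (o + 1) x y → G.E o x y)
    (hR : G.P (1, o) (o + 2) e) : False := by
  have noO : ∀ {x z y}, G.A (o + 2) x z → G.A o z y → G.E o x y → False := by
    intro x z y h1 h2 h3
    have h4 := (G.A_dd (G.E_in (G.E_symm h3) h2)).1
    have h5 := (G.A_dd h1).2
    omega
  have noRo : ¬ G.P (1, o) (o + 2) o := by
    rintro ⟨x, z, y, h0, h1, h2⟩
    exact noO h1 h2 (hD _ _ h0)
  have noRp : ¬ G.P (1, o) (o + 2) (o + 1) := by
    intro h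
    obtain ⟨x, z, y, h0, h1, h2⟩ := id h
    obtain ⟨u, h3, h4⟩ := G.E_of_P (p := o + 1) h h1
    have hE : G.E o z x := G.E_trans (hD _ _ h4) (G.E_symm (hD _ _ h3))
    have hc : G.Circ ((o + 2) :: List.replicate o o) := ⟨x, z, h1, G.pure_E hp hE⟩
    exact G.short hc List.mem_cons_self (by simp)
  obtain ⟨x0, z0, y0, g0, g1, g2⟩ := id hR
  have g0' : G.A (o + 1) x0 y0 := g0
  have T1 : G.Circ ((o + 2) :: e :: List.replicate o o) :=
    ⟨x0, z0, g1, y0, g2, G.pure_E hp (G.E_symm (hD _ _ g0))⟩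
  obtain ⟨m, rfl⟩ : ∃ m, o = m + 2 := ⟨o - 2, by omega⟩
  have T1' := G.C_perm T1
    (l' := (m + 2 + 2) :: (m + 2) :: e :: (m + 2) :: List.replicate m (m + 2))
      (List.perm_iff_count.2 fun a => by
        simp only [List.replicate_succ, List.count_cons]; ring)
  have hBo := (G.step T1' (by simp) (by omega)).resolve_left (fun h => noRo h.1)
  -- the square of p
  obtain ⟨y1, g3⟩ := G.A_ex g0' y0
  have hE : G.E (m + 2) x0 y1 := G.E_trans (hD _ _ g0') (hD _ _ g3)
  have d1 := G.W_dd (G.pure_E hp (G.E_symm hE))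
  simp only [List.length_replicate] at d1
  have d2 := G.dd_tri y0 y1 x0
  have d3 := (G.A_dd g0').2
  have d4 := (G.A_dd g0').1
  have d5 := (G.A_dd g3).1
  have d6 := G.dd_tri x0 y0 y1
  have d8 : ddist G.adj x0 y1 ≠ 0 := by
    intro h
    have := G.dd_zero h
    subst this
    rw [G.dd_self] at d2
    omega
  have hpp : G.Circ ((m + 2 + 1) :: List.replicate (m + 2) (m + 2 + 1)) := by
    rcases (by omega : ddist G.adj x0 y1 = 1 ∨ ddist G.adj x0 y1 = 2) with d | d <;>
    rcases (by omega : ddist G.adj y1 x0 = m + 2 ∨ ddist G.adj y1 x0 = m + 1) with d' | d'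
    · exfalso
      have h : G.A (m + 2 + 1) x0 y1 := by simp [A, tdist, d, d']
      exact G.E_irr g0' ⟨y1, h, g3⟩
    · exfalso
      have h : G.A (m + 2) x0 y1 := by simp [A, tdist, d, d']
      exact G.E_irr h hE
    · exfalso
      have h : tdist G.adj x0 y1 = (2, m + 2) := by simp [tdist, d, d']
      obtain ⟨z, h1, h2⟩ := G.P_use hBo h
      exact noO h1 h2 hE
    · have h : tdist G.adj x0 y1 = (2, m + 1) := by simp [tdist, d, d']
      obtain ⟨w, hw, hW⟩ := G.W_ex y1 x0
      have hc : G.Circ ((m + 2 + 1) :: (m + 2 + 1) :: w) := ⟨x0, y0, g0', y1, g3, hW⟩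
      rcases G.ppw (by omega) IH hc (by omega) ⟨x0, y0, y1, h, g0', g3⟩ with hw2 | ⟨hw2, -⟩
      · have := List.eq_replicate_of_mem hw2
        rw [hw, d'] at this
        rw [this] at hc
        exact hc
      · exfalso
        have hw2 : (m + 2) ∈ w := hw2
        have hperm := List.perm_cons_erase hw2
        have hlen := hperm.length_eq
        simp only [List.length_cons] at hlen
        have hc1 := G.absb hD (G.C_perm hc (l' := (m + 2 + 1) :: (m + 2) :: (m + 2 + 1) :: w.erase (m + 2))
          (((hperm.cons _).trans (List.Perm.swap _ _ _)).cons _))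
        exact G.short (q := m + 2 + 1) hc1 (by simp) (by simp; omega)
  have T8 := G.ins (p := m + 2 + 1) hR hpp
  have T8' := G.C_perm T8
    (l' := (m + 2 + 2) :: (m + 2 + 1) :: e :: List.replicate (m + 1) (m + 2 + 1))
      (List.perm_iff_count.2 fun a => by
        simp only [List.replicate_succ, List.count_cons]; ring)
  have hBp := (G.step T8' (by simp) (by omega)).resolve_left (fun h => noRp h.1)
  have T9 := G.exchC hBo hBp T1'
  have T10 := G.absb hD (G.C_perm T9
    (l' := (m + 2 + 1) :: (m + 2) :: (m + 2 + 2) :: e :: List.replicate m (m + 2))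
      (List.perm_iff_count.2 fun a => by simp only [List.count_cons]; ring))
  exact G.short (q := m + 2 + 2) T10 (by simp) (by simp)

theorem caseC {o e : ℕ} (ho : 2 ≤ o) (IH : ∀ f < o + 2, G.PureL f ∨ G.CL f ∨ G.DL f)
    (hp : G.PureL o) (hC : G.P (1, o - 1) (o + 1) (o + 1)) (hnp : ¬ G.PureL (o + 1))
    (hR : G.P (1, o) (o + 2) e) : False := by
  obtain ⟨m, rfl⟩ : ∃ m, o = m + 2 := ⟨o - 2, by omega⟩
  obtain ⟨x0, z0, y0, g0, g1, g2⟩ := id hC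
  have g0' : G.A (m + 2) x0 y0 := g0
  have hoo : G.Circ ((m + 2) :: List.replicate (m + 1) (m + 2)) := ⟨x0, G.pure_pow hp g0' x0⟩
  have hppo := G.ins hC hoo
  -- basic circuit
  have T : ∀ e, G.P (1, m + 2) (m + 2 + 2) e →
      G.Circ ((m + 2 + 2) :: e :: (m + 2 + 1) :: (m + 2) :: List.replicate m (m + 2)) :=
    fun e he => G.ins (p := m + 2 + 1) he hppo
  have nopp : ¬ G.Circ (List.replicate (m + 3) (m + 2 + 1)) := by
    intro h
    have := G.three hC (l := List.replicate m (m + 2 + 1)) h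
    exact G.short (q := m + 2 + 1) this (by simp) (by simp)
  have Xp : ∀ {f l}, G.Circ ((m + 2 + 2) :: l) → l.length + 1 = m + 2 + 2 →
      (∀ s ∈ l, G.P (2, m + 2 + 2 - 2) (m + 2 + 2) s) → f ∈ l → f < m + 2 + 2 → False := by
    intro f l h1 h2 h3 h4 h5
    exact hnp (G.X IH h1 h2 h3 h4 h5).2.1
  have noRo : ¬ G.P (1, m + 2) (m + 2 + 2) (m + 2) := by
    intro h
    have h1 := G.C_perm (T _ h)
      (l' := (m + 2 + 2) :: (m + 2 + 1) :: List.replicate (m + 2) (m + 2))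
      (List.perm_iff_count.2 fun a => by
        simp only [List.replicate_succ, List.count_cons]; ring)
    obtain ⟨x, a, h2, b, h3, h4⟩ := h1
    have hE := G.E_mono hC (G.E_pure hp ho h4)
    have h5 : G.Circ [m + 2 + 2, m + 2 + 1] := ⟨x, a, h2, x, G.E_in hE h3, rfl⟩
    exact G.short (q := m + 2 + 2) h5 (by simp) (by simp)
  have noRq : ¬ G.P (1, m + 2) (m + 2 + 2) (m + 2 + 2) := by
    intro h
    have h1 := T _ h
    have h2 := G.C_perm h1
      (l' := (m + 2 + 2) :: (m + 2 + 1) :: (m + 2 + 2) :: (m + 2) :: List.replicate m (m + 2))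
      (List.perm_iff_count.2 fun a => by simp only [List.count_cons]; ring)
    have h3 := G.C_perm h1
      (l' := (m + 2 + 2) :: (m + 2) :: (m + 2 + 2) :: (m + 2 + 1) :: List.replicate m (m + 2))
      (List.perm_iff_count.2 fun a => by simp only [List.count_cons]; ring)
    have hBp := (G.step h2 (by simp) (by omega)).resolve_left
      (fun h => G.short (q := m + 2 + 2) h.2 (by simp) (by simp))
    have hBo := (G.step h3 (by simp) (by omega)).resolve_left
      (fun h => G.short (q := m + 2 + 2) h.2 (by simp) (by simp))
    obtain ⟨x, a, h4, h5⟩ := h1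
    have h6 := G.exch_all hBp (l := (m + 2 + 1) :: (m + 2) :: List.replicate m (m + 2)) (by
      intro t ht
      simp only [List.mem_cons, List.mem_replicate] at ht
      rcases ht with rfl | rfl | ⟨-, rfl⟩ <;> assumption) h5
    simp only [List.length_cons, List.length_replicate] at h6
    have h7 : G.Circ ((m + 2 + 2) :: (m + 2 + 2) :: List.replicate (m + 1 + 1) (m + 2 + 1)) :=
      ⟨x, a, h4, h6⟩
    rcases G.step h7 (by simp) (by omega) with h | hBq
    · exact nopp h.2
    · refine Xp (f := m + 2 + 1) h7 (by simp) ?_ (by simp) (by omega)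
      intro t ht
      simp only [List.mem_cons, List.mem_replicate] at ht
      rcases ht with rfl | ⟨-, rfl⟩ <;> assumption
  have T1 := T _ hR
  have T1o := G.C_perm T1
      (l' := (m + 2 + 2) :: (m + 2) :: e :: (m + 2 + 1) :: List.replicate m (m + 2))
      (List.perm_iff_count.2 fun a => by simp only [List.count_cons]; ring)
  have hBo := (G.step T1o (by simp) (by omega)).resolve_left (fun h => noRo h.1)
  have noRp : ¬ G.P (1, m + 2) (m + 2 + 2) (m + 2 + 1) := by
    intro h
    have h1 := G.C_perm (T _ h)
      (l' := (m + 2 + 1) :: (m + 2 + 1) :: (m + 2 + 2) :: (m + 2) :: List.replicate m (m + 2))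
      (List.perm_iff_count.2 fun a => by simp only [List.count_cons]; ring)
    obtain ⟨x, a, h1, y, h2, h3⟩ := h1
    have d1 := G.W_dd h3
    simp only [List.length_cons, List.length_replicate] at d1
    have d2 := G.dd_tri a y x
    have d3 := (G.A_dd h1).2
    have d4 := (G.A_dd h1).1
    have d5 := (G.A_dd h2).1
    have d6 := G.dd_tri x a y
    have d8 : ddist G.adj x y ≠ 0 := by
      intro h
      have := G.dd_zero h
      subst this
      rw [G.dd_self] at d2
      omega
    rcases (by omega : ddist G.adj x y = 1 ∨ ddist G.adj x y = 2) with d | d <;>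
    rcases (by omega : ddist G.adj y x = m + 2 ∨ ddist G.adj y x = m + 1) with d' | d'
    · have h : G.A (m + 2 + 1) x y := by simp [A, tdist, d, d']
      exact G.E_irr h1 ⟨y, h, h2⟩
    · have h : G.A (m + 2) x y := by simp [A, tdist, d, d']
      have hc : G.Circ ((m + 2) :: (m + 2 + 2) :: (m + 2) :: List.replicate m (m + 2)) :=
        ⟨x, y, h, h3⟩
      exact G.short (q := m + 2 + 2) hc (by simp) (by simp)
    · have h : tdist G.adj x y = (2, m + 2) := by simp [tdist, d, d']
      obtain ⟨z, h4, h5⟩ := G.P_use hBo h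
      have hc : G.Circ ((m + 2 + 2) :: (m + 2) :: (m + 2 + 2) :: (m + 2) :: List.replicate m (m + 2)) :=
        ⟨x, z, h4, y, h5, h3⟩
      have hc1 := G.C_perm hc
        (l' := (m + 2 + 2) :: (m + 2 + 2) :: (m + 2) :: (m + 2) :: List.replicate m (m + 2))
        (List.perm_iff_count.2 fun a => by simp only [List.count_cons]; ring)
      have hBq := (G.step hc1 (by simp) (by omega)).resolve_left (fun h => noRq h.1)
      refine Xp (f := m + 2) hc1 (by simp) ?_ (by simp) (by omega)
      intro t ht
      simp only [List.mem_cons, List.mem_replicate] at ht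
      rcases ht with rfl | rfl | rfl | ⟨-, rfl⟩ <;> assumption
    · have h : tdist G.adj x y = (2, m + 1) := by simp [tdist, d, d']
      obtain ⟨w, hw, hW⟩ := G.W_ex y x
      have hc : G.Circ ((m + 2 + 1) :: (m + 2 + 1) :: w) := ⟨x, a, h1, y, h2, hW⟩
      rcases G.ppw (by omega) (fun f hf => IH f (by omega)) hc (by omega)
        ⟨x, a, y, h, h1, h2⟩ with hw2 | ⟨-, hw2⟩
      · have := List.eq_replicate_of_mem hw2
        rw [hw, d'] at this
        rw [this] at hc
        exact nopp hc
      · exact G.E_irr h1 (G.E_mono hC (hw2.2 _ _ h1))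
  have T1p := G.C_perm T1
      (l' := (m + 2 + 2) :: (m + 2 + 1) :: e :: (m + 2) :: List.replicate m (m + 2))
      (List.perm_iff_count.2 fun a => by simp only [List.count_cons]; ring)
  have hBp := (G.step T1p (by simp) (by omega)).resolve_left (fun h => noRp h.1)
  have hle := G.C_le (t := e) T1 (by simp)
  have hge := G.C_ge (t := e) T1 (by simp)
  simp only [List.length_cons, List.length_replicate] at hle
  have he1 : e ≠ m + 2 + 2 := by
    rintro rfl
    exact noRq hR
  have he2 : e ≠ m + 2 + 1 := by
    rintro rfl
    exact noRp hR
  have he3 : e ≠ m + 2 := by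
    rintro rfl
    exact noRo hR
  obtain ⟨k, rfl⟩ : ∃ k, m = k + 1 := ⟨m - 1, by omega⟩
  have T2 := G.C_perm T1
      (l' := e :: (k + 1 + 2 + 2) :: (k + 1 + 2 + 1) :: (k + 1 + 2) :: List.replicate (k + 1) (k + 1 + 2))
      (List.perm_iff_count.2 fun a => by simp only [List.count_cons]; ring)
  obtain ⟨x, a, h4, h5⟩ := T2
  have h6 := G.exch_all hBp (l := (k + 1 + 2 + 1) :: (k + 1 + 2) :: List.replicate (k + 1) (k + 1 + 2)) (by
      intro t ht
      simp only [List.mem_cons, List.mem_replicate] at ht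
      rcases ht with rfl | rfl | ⟨-, rfl⟩ <;> assumption) h5
  simp only [List.length_cons, List.length_replicate] at h6
  have h7 : G.Circ (e :: (k + 1 + 2 + 2) :: List.replicate (k + 1 + 1 + 1) (k + 1 + 2 + 1)) :=
      ⟨x, a, h4, h6⟩
  have h8 := G.three hC (G.C_perm h7
    (l' := (k + 1 + 2 + 1) :: (k + 1 + 2 + 1) :: (k + 1 + 2 + 1) :: e :: (k + 1 + 2 + 2) :: List.replicate k (k + 1 + 2 + 1))
    (List.perm_iff_count.2 fun a => by
        simp only [List.replicate_succ, List.count_cons]; ring))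
  exact G.short (q := k + 1 + 2 + 2) h8 (by simp) (by simp)

theorem main (q : ℕ) : G.PureL q ∨ G.CL q ∨ G.DL q := by
  induction q using Nat.strong_induction_on with
  | _ q IH =>
  by_cases hP : G.PureL q
  · exact Or.inl hP
  right
  have hP' := hP
  unfold PureL at hP
  push Not at hP
  obtain ⟨l, hc, hl, f, hf, hfq⟩ := hP
  have hfle := G.C_le (t := f) hc (by simp [hf])
  have hfge := G.C_ge (t := f) hc (by simp [hf])
  simp only [List.length_cons] at hfle
  obtain ⟨n, rfl⟩ : ∃ n, q = n + 2 := ⟨q - 2, by omega⟩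
  by_cases hpp : G.PureL (n + 1)
  · exact G.pureCase (by omega) IH hpp hc hl hf hfq
  exfalso
  have hex : ∃ e, G.P (1, n) (n + 2) e := by
    by_contra hne
    push Not at hne
    have := G.X IH hc hl (fun s hs =>
      (G.stepMem hc hl (by omega) hs).resolve_left (fun h => hne s h.1)) hf (by omega)
    exact hpp this.2.1
  obtain ⟨e, he⟩ := hex
  rcases (IH (n + 1) (by omega)).resolve_left hpp with hC | hD
  · have := G.CL_ge hC
    exact G.caseC (by omega) IH hC.1 hC.2 hpp he
  · obtain ⟨x, z, y, h0, -, -⟩ := id he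
    have := G.E_ge (hD.2 x y h0)
    exact G.caseD this (fun f hf => IH f (by omega)) hD.1 hD.2 he

end CTWDR

/-- Theorem 3.1: `C(q)` or `D(q)` exists iff `(1, q-1)` is mixed. -/
theorem stmt9 {V : Type*} [Fintype V] (G : CTWDR V) (q : ℕ) (hq : 2 ≤ q)
    (hatt : Attained G.adj (1, q - 1)) :
    (G.Cexists q ∨ G.Dexists q) ↔ G.Mixed q := by
  have hq2 : q - 1 - 1 = q - 2 := by omega
  constructor
  · intro h hP
    rw [G.pure_iff] at hP
    rcases h with ⟨h, hp⟩ | ⟨h, hp⟩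
    · rw [G.pure_iff] at hp
      obtain ⟨x, z, y, h0, h1, h2⟩ := G.pnum_ne.1 h
      have h0' : G.A (q - 1) x y := by
        unfold CTWDR.A
        rw [hq2]
        exact h0
      have hge := G.A_ge h0'
      have hw := G.pure_pow hp h0' y
      obtain ⟨l, hl, hW⟩ := G.W_ex y x
      have hd := (G.A_dd h0').2
      have hall := hp l ⟨x, y, h0', hW⟩ (by omega)
      have := hP (q :: l) ⟨x, z, h1, y, h2, hW⟩ (by simp; omega)
      obtain ⟨t, ht⟩ := List.exists_mem_of_length_pos (l := l) (by omega)
      have e1 := hall t ht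
      have e2 := this t (by simp [ht])
      omega
    · obtain ⟨x, z, y, h0, h1, h2⟩ := G.pnum_ne.1 h
      have h1' : G.A (q - 1) x z := by
        unfold CTWDR.A
        rw [hq2]
        exact h1
      have h2' : G.A (q - 1) y z := by
        unfold CTWDR.A
        rw [hq2]
        exact (G.td_swap' (i := (1, q - 2))).1 h2
      have hge := G.A_ge h1'
      obtain ⟨l, hl, hW⟩ := G.W_ex z x
      have hd := (G.A_dd h1').2
      have := hP ((q - 1) :: l) ⟨x, y, h0, z, h2', hW⟩ (by simp; omega) (q - 1) (by simp)
      omega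
  · intro hM
    have hM' : ¬ G.PureL q := fun h => hM (G.pure_iff.2 h)
    rcases (G.main q).resolve_left hM' with ⟨hp, x, z, y, h0, h1, h2⟩ | ⟨hp, hD⟩
    · exact Or.inl ⟨G.pnum_ne.2 ⟨x, z, y, h0, h1, h2⟩, G.pure_iff.2 hp⟩
    · obtain ⟨x, y, h0⟩ := hatt
      obtain ⟨z, h1, h2⟩ := hD x y h0
      unfold CTWDR.A at h1 h2
      rw [hq2] at h1 h2
      exact Or.inr ⟨G.pnum_ne.2 ⟨x, z, y, h0, h1, (G.td_swap' (i := (1, q - 2))).2 h2⟩,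
        G.pure_iff.2 hp⟩
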